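/- Let p : E → ℝ be C¹ and positive, and let r : E → E be C¹. If ∫ ⟪∇φ(x), r(x)⟫ · p(x) dx = 0 for every smooth (C^∞) compactly supported φ : E → ℝ, then div r(x) + ⟪r(x), ∇(Real.log ∘ p)(x)⟫ = 0 for every x ∈ E. (Weak orthogonality to all conservative fields implies the pointwise gauge freedom condition.) -/

import Mathlib

open scoped RealInnerProductSpace
open MeasureTheory

/-- The divergence of a vector field `v` at `x`: the trace of its Fréchet derivative. -/
noncomputable def div {D : ℕ} (v : EuclideanSpace ℝ (Fin D) → EuclideanSpace ℝ (Fin D))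
    (x : EuclideanSpace ℝ (Fin D)) : ℝ :=
  LinearMap.trace ℝ (EuclideanSpace ℝ (Fin D)) (fderiv ℝ v x).toLinearMap

theorem div_eq_sum_inner {D : ℕ} (v : EuclideanSpace ℝ (Fin D) → EuclideanSpace ℝ (Fin D))
    (x : EuclideanSpace ℝ (Fin D)) :
    div v x = ∑ i, ⟪EuclideanSpace.basisFun (Fin D) ℝ i,
      fderiv ℝ v x (EuclideanSpace.basisFun (Fin D) ℝ i)⟫ :=
  LinearMap.trace_eq_sum_inner _ (EuclideanSpace.basisFun (Fin D) ℝ)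

theorem continuous_div {D : ℕ} {v : EuclideanSpace ℝ (Fin D) → EuclideanSpace ℝ (Fin D)}
    (hv : ContDiff ℝ 1 v) : Continuous (div v) := by
  rw [funext (div_eq_sum_inner v)]
  have := hv.continuous_fderiv one_ne_zero
  fun_prop

/-- Integration by parts for the divergence against a compactly supported `C¹` function. -/
theorem integral_mul_div_eq_neg_integral_inner_gradient {D : ℕ}
    {v : EuclideanSpace ℝ (Fin D) → EuclideanSpace ℝ (Fin D)} (hv : ContDiff ℝ 1 v)
    {φ : EuclideanSpace ℝ (Fin D) → ℝ} (hφ : ContDiff ℝ 1 φ) (hsupp : HasCompactSupport φ) :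
    ∫ x, φ x * div v x = -∫ x, ⟪gradient φ x, v x⟫ := by
  set b := EuclideanSpace.basisFun (Fin D) ℝ
  have hv' := hv.continuous_fderiv one_ne_zero
  have hφ' := hφ.continuous_fderiv one_ne_zero
  have hvc := hv.continuous
  have hφc := hφ.continuous
  have fderiv_coord (i : Fin D) (x : EuclideanSpace ℝ (Fin D)) :
      fderiv ℝ (fun y ↦ ⟪b i, v y⟫) x (b i) = ⟪b i, fderiv ℝ v x (b i)⟫ := by
    rw [fderiv_inner_apply ℝ (by fun_prop) ((hv.differentiable one_ne_zero) x)]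
    simp
  have integrable_left (i : Fin D) :
      Integrable fun x ↦ φ x * ⟪b i, fderiv ℝ v x (b i)⟫ :=
    (by fun_prop : Continuous _).integrable_of_hasCompactSupport hsupp.mul_right
  have integrable_right (i : Fin D) :
      Integrable fun x ↦ fderiv ℝ φ x (b i) * ⟪b i, v x⟫ :=
    (by fun_prop : Continuous _).integrable_of_hasCompactSupport
      (hsupp.fderiv_apply (𝕜 := ℝ) (b i)).mul_right
  have parts (i : Fin D) :
      ∫ x, φ x * ⟪b i, fderiv ℝ v x (b i)⟫ = -∫ x, fderiv ℝ φ x (b i) * ⟪b i, v x⟫ := by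
    simp_rw [← fderiv_coord]
    refine integral_mul_fderiv_eq_neg_fderiv_mul_of_integrable (integrable_right i) ?_ ?_ ?_ ?_
    · simpa only [fderiv_coord] using integrable_left i
    · exact (by fun_prop : Continuous _).integrable_of_hasCompactSupport hsupp.mul_right
    · exact fun x _ ↦ (hφ.differentiable one_ne_zero) x
    · exact fun x _ ↦ (contDiff_const.inner ℝ hv).differentiable one_ne_zero x
  have gradient_expand (x : EuclideanSpace ℝ (Fin D)) :
      ⟪gradient φ x, v x⟫ = ∑ i, fderiv ℝ φ x (b i) * ⟪b i, v x⟫ := by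
    rw [← b.sum_inner_mul_inner]
    simp [gradient]
  simp_rw [gradient_expand, div_eq_sum_inner, Finset.mul_sum]
  rw [integral_finsetSum _ fun i _ ↦ integrable_left i,
    integral_finsetSum _ fun i _ ↦ integrable_right i, ← Finset.sum_neg_distrib]
  exact Finset.sum_congr rfl fun i _ ↦ parts i

theorem div_smul {D : ℕ} {p : EuclideanSpace ℝ (Fin D) → ℝ}
    {r : EuclideanSpace ℝ (Fin D) → EuclideanSpace ℝ (Fin D)} {x : EuclideanSpace ℝ (Fin D)}
    (hp : DifferentiableAt ℝ p x) (hr : DifferentiableAt ℝ r x) :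
    div (fun y ↦ p y • r y) x = p x * div r x + fderiv ℝ p x (r x) := by
  have h : (fderiv ℝ (fun y ↦ p y • r y) x).toLinearMap =
      p x • (fderiv ℝ r x).toLinearMap + (fderiv ℝ p x).toLinearMap.smulRight (r x) := by
    rw [fderiv_fun_smul hp hr]
    rfl
  simp [div, h]

/-- Weak orthogonality to all conservative fields (gradients of smooth compactly
supported potentials) implies the pointwise gauge freedom condition. -/
theorem stmt4 (D : ℕ) (hD : 1 ≤ D)
    (p : EuclideanSpace ℝ (Fin D) → ℝ) (hp : ContDiff ℝ 1 p)
    (hppos : ∀ x, 0 < p x)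
    (r : EuclideanSpace ℝ (Fin D) → EuclideanSpace ℝ (Fin D)) (hr : ContDiff ℝ 1 r)
    (horth : ∀ φ : EuclideanSpace ℝ (Fin D) → ℝ, ContDiff ℝ (⊤ : ℕ∞) φ → HasCompactSupport φ →
      ∫ x, ⟪gradient φ x, r x⟫ * p x = 0) :
    ∀ x, div r x + ⟪r x, gradient (Real.log ∘ p) x⟫ = 0 := by
  have hw : ContDiff ℝ 1 fun y ↦ p y • r y := hp.smul hr
  have hae : div (fun y ↦ p y • r y) =ᵐ[volume] fun _ ↦ 0 := by
    refine ae_eq_zero_of_integral_contDiff_smul_eq_zero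
      (continuous_div hw).locallyIntegrable fun φ hφ hsupp ↦ ?_
    have key := integral_mul_div_eq_neg_integral_inner_gradient hw
      (hφ.of_le (by exact_mod_cast le_top)) hsupp
    simp_rw [inner_smul_right, mul_comm (p _), horth φ hφ hsupp, neg_zero] at key
    exact key
  have hzero := Continuous.ae_eq_iff_eq volume (continuous_div hw) continuous_const |>.1 hae
  intro x
  have hpx := hp.differentiable one_ne_zero x
  have hdiv := congrFun hzero x
  rw [div_smul hpx (hr.differentiable one_ne_zero x)] at hdiv
  have hlog : ⟪r x, gradient (Real.log ∘ p) x⟫ = (p x)⁻¹ * fderiv ℝ p x (r x) := by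
    have hfderiv : fderiv ℝ (Real.log ∘ p) x = (p x)⁻¹ • fderiv ℝ p x :=
      (hpx.hasFDerivAt.log (hppos x).ne').fderiv
    rw [real_inner_comm, gradient, InnerProductSpace.toDual_symm_apply, hfderiv]
    simp
  rw [hlog]
  have hne := (hppos x).ne'
  field_simp
  linarith
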